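/- Fix x > 0 and ε ∈ (0, 1/2). There exist a constant C > 0 and an integer N₀ such that the following holds: for every probability measure μ on [0,1] satisfying μ((a, b]) ≤ 2(b − a) for all 0 ≤ a ≤ b ≤ 1, every integer N ≥ N₀, and every integer k ≥ 2 with |k − N| ≤ N^{1/2+ε}, setting D(m) := ∫_{[0,1]} (1 − μ((y, y + x/m]))^{m−1} dμ(y), one has |D(k) − D(N)| ≤ C · N^{−1/2+ε}. -/

import Mathlib

open MeasureTheory

lemma aux_ioc (μ : Measure ℝ) [IsProbabilityMeasure μ] (h1 : μ (Set.Icc (0 : ℝ) 1) = 1)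
    (h : ∀ a b : ℝ, 0 ≤ a → a ≤ b → b ≤ 1 → (μ (Set.Ioc a b)).toReal ≤ 2 * (b - a))
    (a b : ℝ) (ha : 0 ≤ a) (hab : a ≤ b) : (μ (Set.Ioc a b)).toReal ≤ 2 * (b - a) := by
  have hc : μ (Set.Icc (0 : ℝ) 1)ᶜ = 0 := by
    rw [prob_compl_eq_zero_iff measurableSet_Icc]; exact h1
  have hz : μ (Set.Ioi (1 : ℝ)) = 0 := by
    refine measure_mono_null ?_ hc
    intro z hz hz2
    exact absurd hz2.2 (not_le.mpr hz)
  by_cases hb : b ≤ 1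
  · exact h a b ha hab hb
  by_cases ha1 : a ≤ 1
  · have : μ (Set.Ioc a b) ≤ μ (Set.Ioc a 1) := by
      calc μ (Set.Ioc a b) ≤ μ (Set.Ioc a 1 ∪ Set.Ioi 1) := by
            apply measure_mono
            intro z hz
            rcases le_or_gt z 1 with h | h
            · exact Or.inl ⟨hz.1, h⟩
            · exact Or.inr h
        _ ≤ μ (Set.Ioc a 1) + μ (Set.Ioi 1) := measure_union_le _ _
        _ = μ (Set.Ioc a 1) := by rw [hz, add_zero]
    have h2 := ENNReal.toReal_mono (measure_ne_top _ _) this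
    have h3 := h a 1 ha ha1 le_rfl
    linarith
  · have : μ (Set.Ioc a b) = 0 := by
      refine measure_mono_null ?_ hz
      intro z hz
      exact lt_trans (not_le.mp ha1) hz.1
    rw [this]
    simp
    exact hab

lemma aux_diff (μ : Measure ℝ) [IsProbabilityMeasure μ] (h1 : μ (Set.Icc (0 : ℝ) 1) = 1)
    (h : ∀ a b : ℝ, 0 ≤ a → a ≤ b → b ≤ 1 → (μ (Set.Ioc a b)).toReal ≤ 2 * (b - a))
    (y s t : ℝ) (hy : 0 ≤ y) (hs : 0 ≤ s) (hst : s ≤ t) :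
    |(μ (Set.Ioc y (y + s))).toReal - (μ (Set.Ioc y (y + t))).toReal| ≤ 2 * (t - s) := by
  have e : Set.Ioc y (y + t) = Set.Ioc y (y + s) ∪ Set.Ioc (y + s) (y + t) :=
    (Set.Ioc_union_Ioc_eq_Ioc (by linarith) (by linarith)).symm
  have e2 : (μ (Set.Ioc y (y + t))).toReal ≤
      (μ (Set.Ioc y (y + s))).toReal + (μ (Set.Ioc (y + s) (y + t))).toReal := by
    rw [e]; exact measureReal_union_le _ _
  have e3 : (μ (Set.Ioc y (y + s))).toReal ≤ (μ (Set.Ioc y (y + t))).toReal :=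
    ENNReal.toReal_mono (measure_ne_top _ _)
      (measure_mono (Set.Ioc_subset_Ioc le_rfl (by linarith)))
  have := aux_ioc μ h1 h (y + s) (y + t) (by linarith) (by linarith)
  rw [abs_le]; constructor <;> linarith

lemma aux_pow (a b : ℝ) (ha : 0 ≤ a) (ha1 : a ≤ 1) (hb : 0 ≤ b) (hb1 : b ≤ 1) (n : ℕ) :
    |a ^ n - b ^ n| ≤ n * |a - b| := by
  induction n with
  | zero => simp
  | succ n ih =>
    have : a ^ (n+1) - b ^ (n+1) = a * (a ^ n - b ^ n) + (a - b) * b ^ n := by ring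
    rw [this]
    refine (abs_add_le _ _).trans ?_
    rw [abs_mul, abs_mul, abs_of_nonneg ha, abs_of_nonneg (pow_nonneg hb n)]
    have h1 : b ^ n ≤ 1 := pow_le_one₀ hb hb1
    have h2 : a * |a ^ n - b ^ n| ≤ |a ^ n - b ^ n| := mul_le_of_le_one_left (abs_nonneg _) ha1
    have h3 : |a - b| * b ^ n ≤ |a - b| := mul_le_of_le_one_right (abs_nonneg _) h1
    push_cast
    linarith

lemma aux_exp0 (b : ℝ) (hb : 0 ≤ b) (hb1 : b ≤ 1) (m d : ℕ) :
    |b ^ m - b ^ (m + d)| ≤ d * (1 - b) := by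
  have e : b ^ m - b ^ (m + d) = b ^ m * (1 ^ d - b ^ d) := by rw [pow_add]; ring
  have := aux_pow 1 b zero_le_one le_rfl hb hb1 d
  rw [e, abs_mul, abs_of_nonneg (pow_nonneg hb m)]
  rw [abs_of_nonneg (by linarith : 0 ≤ 1 - b)] at this
  exact (mul_le_of_le_one_left (abs_nonneg _) (pow_le_one₀ hb hb1)).trans this

lemma aux_exp (b : ℝ) (hb : 0 ≤ b) (hb1 : b ≤ 1) (m n : ℕ) :
    |b ^ m - b ^ n| ≤ |(m : ℝ) - n| * (1 - b) := by
  rcases le_total m n with h | h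
  · obtain ⟨d, rfl⟩ := Nat.exists_eq_add_of_le h
    have := aux_exp0 b hb hb1 m d
    simpa using this
  · obtain ⟨d, rfl⟩ := Nat.exists_eq_add_of_le h
    have := aux_exp0 b hb hb1 n d
    rw [abs_sub_comm]
    simpa using this

lemma aux_int (μ : Measure ℝ) [IsProbabilityMeasure μ] (c : ℝ) (n : ℕ) :
    Integrable (fun y => (1 - (μ (Set.Ioc y (y + c))).toReal) ^ n) μ := by
  have hm : Measurable (fun y => μ (Set.Ioc y (y + c))) := by
    have hs : MeasurableSet {p : ℝ × ℝ | p.1 < p.2 ∧ p.2 ≤ p.1 + c} :=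
      (measurableSet_lt measurable_fst measurable_snd).inter
        (measurableSet_le measurable_snd (measurable_fst.add_const c))
    exact measurable_measure_prodMk_left hs
  refine Integrable.of_bound (C := 1)
    ((measurable_const.sub hm.ennreal_toReal).pow_const n).aestronglyMeasurable ?_
  refine Filter.Eventually.of_forall fun y => ?_
  have h1 : (μ (Set.Ioc y (y + c))).toReal ≤ 1 := measureReal_le_one
  have h0 : 0 ≤ (μ (Set.Ioc y (y + c))).toReal := ENNReal.toReal_nonneg
  rw [norm_pow, Real.norm_eq_abs, abs_of_nonneg (by linarith)]
  exact pow_le_one₀ (by linarith) (by linarith)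

/-- Stability of the expected spacing proportion under a fluctuation of the number of points:
if `μ` is a probability measure on `[0,1]` with increments bounded by twice the Lebesgue
length, and `|k − N| ≤ N^{1/2+ε}`, then `|D(k) − D(N)| ≤ C N^{−1/2+ε}`, where
`D(m) = ∫ (1 − μ((y, y + x/m]))^{m−1} dμ(y)`. -/
theorem spacing_integral_stability (x : ℝ) (hx : 0 < x) (ε : ℝ) (hε : ε ∈ Set.Ioo (0 : ℝ) (1/2)) :
    ∃ C > (0 : ℝ), ∃ N₀ : ℕ,
      ∀ (μ : Measure ℝ), IsProbabilityMeasure μ → μ (Set.Icc (0 : ℝ) 1) = 1 →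
      (∀ a b : ℝ, 0 ≤ a → a ≤ b → b ≤ 1 → (μ (Set.Ioc a b)).toReal ≤ 2 * (b - a)) →
      ∀ N : ℕ, N₀ ≤ N → ∀ k : ℕ, 2 ≤ k →
      |(k : ℝ) - (N : ℝ)| ≤ (N : ℝ) ^ ((1 : ℝ) / 2 + ε) →
      |(∫ y, (1 - (μ (Set.Ioc y (y + x / k))).toReal) ^ (k - 1) ∂μ)
        - ∫ y, (1 - (μ (Set.Ioc y (y + x / N))).toReal) ^ (N - 1) ∂μ|
        ≤ C * (N : ℝ) ^ (-(1 : ℝ) / 2 + ε) := by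
  refine ⟨4 * x, by positivity, 1, ?_⟩
  intro μ hμ h1 h N hN k hk hkN
  have hN0 : (0 : ℝ) < N := by exact_mod_cast hN
  have hk0 : (0 : ℝ) < k := by exact_mod_cast (by omega : 0 < k)
  rw [← integral_sub (aux_int μ _ _) (aux_int μ _ _)]
  have key : ∀ y : ℝ, 0 ≤ y → ‖(1 - (μ (Set.Ioc y (y + x / k))).toReal) ^ (k - 1)
      - (1 - (μ (Set.Ioc y (y + x / N))).toReal) ^ (N - 1)‖ ≤ 4 * x * (|(k : ℝ) - N| / N) := by
    intro y hy
    have hpq : |(μ (Set.Ioc y (y + x / k))).toReal - (μ (Set.Ioc y (y + x / N))).toReal|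
        ≤ 2 * (x * |(k : ℝ) - N| / (k * N)) := by
      rcases le_total (k : ℝ) N with hle | hle
      · have := aux_diff μ h1 h y (x / N) (x / k) hy (by positivity)
          (div_le_div_of_nonneg_left hx.le hk0 hle)
        rw [abs_sub_comm]
        refine this.trans (le_of_eq ?_)
        rw [abs_of_nonpos (by linarith)]
        field_simp
        ring
      · have := aux_diff μ h1 h y (x / k) (x / N) hy (by positivity)
          (div_le_div_of_nonneg_left hx.le hN0 hle)
        refine this.trans (le_of_eq ?_)
        rw [abs_of_nonneg (by linarith)]
        field_simp
    have hq : (μ (Set.Ioc y (y + x / N))).toReal ≤ 2 * (x / N) := by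
      have hxN : 0 ≤ x / N := by positivity
      have := aux_ioc μ h1 h y (y + x / N) hy (by linarith)
      linarith
    have hp1 : (μ (Set.Ioc y (y + x / k))).toReal ≤ 1 := measureReal_le_one
    have hp0 : 0 ≤ (μ (Set.Ioc y (y + x / k))).toReal := ENNReal.toReal_nonneg
    have hq1 : (μ (Set.Ioc y (y + x / N))).toReal ≤ 1 := measureReal_le_one
    have hq0 : 0 ≤ (μ (Set.Ioc y (y + x / N))).toReal := ENNReal.toReal_nonneg
    generalize (μ (Set.Ioc y (y + x / k))).toReal = p at *
    generalize (μ (Set.Ioc y (y + x / N))).toReal = q at *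
    have A := aux_pow (1 - p) (1 - q) (by linarith) (by linarith) (by linarith) (by linarith) (k - 1)
    have B := aux_exp (1 - q) (by linarith) (by linarith) (k - 1) (N - 1)
    rw [Nat.cast_sub (by omega : 1 ≤ k)] at A B
    rw [Nat.cast_sub hN] at B
    rw [show (1 - p) - (1 - q) = -(p - q) by ring, abs_neg] at A
    rw [show ((k : ℝ) - (1 : ℕ)) - ((N : ℝ) - (1 : ℕ)) = k - N by ring,
      show 1 - (1 - q) = q by ring] at B
    have A2 : ((k : ℝ) - (1 : ℕ)) * |p - q| ≤ 2 * x * (|(k : ℝ) - N| / N) := by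
      calc ((k : ℝ) - (1 : ℕ)) * |p - q| ≤ k * |p - q| := by
            apply mul_le_mul_of_nonneg_right _ (abs_nonneg _)
            simp
        _ ≤ k * (2 * (x * |(k : ℝ) - N| / (k * N))) := by gcongr
        _ = _ := by field_simp
    have B2 : |(k : ℝ) - N| * q ≤ 2 * x * (|(k : ℝ) - N| / N) := by
      calc |(k : ℝ) - N| * q ≤ |(k : ℝ) - N| * (2 * (x / N)) := by gcongr
        _ = _ := by ring
    rw [Real.norm_eq_abs]
    have := abs_sub_le ((1 - p) ^ (k - 1)) ((1 - q) ^ (k - 1)) ((1 - q) ^ (N - 1))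
    have e : 4 * x * (|(k : ℝ) - N| / N) =
        2 * x * (|(k : ℝ) - N| / N) + 2 * x * (|(k : ℝ) - N| / N) := by ring
    rw [e]
    exact this.trans (add_le_add (A.trans A2) (B.trans B2))
  have hae : ∀ᵐ y ∂μ, y ∈ Set.Icc (0 : ℝ) 1 := by
    have h2 := (prob_compl_eq_zero_iff (μ := μ) (measurableSet_Icc (a := (0 : ℝ)) (b := 1))).2 h1
    exact mem_ae_iff.2 h2
  have := norm_integral_le_of_norm_le_const (hae.mono fun y hy => key y hy.1)
  rw [Real.norm_eq_abs] at this
  refine this.trans ?_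
  rw [probReal_univ, mul_one]
  refine mul_le_mul_of_nonneg_left ?_ (by positivity)
  rw [div_le_iff₀ hN0]
  refine hkN.trans (le_of_eq ?_)
  rw [← Real.rpow_add_one hN0.ne']
  congr 1
  ring
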